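/- Let g = (1/136)g¹ − (121/2176)g² + (1/136)g³ − (60/17)g⁴ − (60/17)g⁵, where g¹(z)=E₈(z), g²(z)=16E₈(2z), g³(z)=256E₈(4z), g⁴(z)=f(z), g⁵(z)=16f(2z). Then g = 1 + 7680q³ + 4320q⁴ + 276480q⁵ + O(q⁶); in particular the coefficients of q¹ and q² vanish. -/

import Mathlib

open Complex ArithmeticFunction
open scoped Real UpperHalfPlane

/-- `q = e^{2πiz}`. -/
noncomputable def qexp (z : ℍ) : ℂ := Complex.exp (2 * Real.pi * Complex.I * z)

/-- The weight-8 Eisenstein series `E₈(z) = 1 + 480 ∑_{n≥1} σ₇(n) qⁿ` for `SL₂(ℤ)`. -/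
noncomputable def E8fun (z : ℍ) : ℂ :=
  1 + 480 * ∑' n : ℕ, (sigma 7 (n + 1) : ℂ) * qexp z ^ (n + 1)

/-- The weight-8 newform `f(z) = q ∏_{n≥1} (1-qⁿ)⁸(1-q^{2n})⁸` for `Γ₀(2)`. -/
noncomputable def newform8fun (z : ℍ) : ℂ :=
  qexp z * ∏' n : ℕ, ((1 - qexp z ^ (n + 1)) ^ 8 * (1 - qexp z ^ (2 * (n + 1))) ^ 8)

/-- The point `m·z` of the upper half plane, for `m` a positive natural number. -/
noncomputable def scaleUH (m : ℕ) (hm : 0 < m) (z : ℍ) : ℍ :=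
  ⟨(m : ℂ) * (z : ℂ), by
    have hz := z.2
    have hm' : (0:ℝ) < (m:ℝ) := by exact_mod_cast hm
    simpa [Complex.mul_im] using mul_pos hm' hz⟩


lemma hasSum_of_eq {E : Type*} [AddCommMonoid E] [TopologicalSpace E] {f g : ℕ → E} {a : E}
    (h : HasSum f a) (e : ∀ n, f n = g n) : HasSum g a :=
  (funext e : f = g) ▸ h

/-- `F` agrees on the unit disc with `a₀ + … + a₄ q⁴ + q⁵ H(q)`, `H` holomorphic. -/
def Ex5 (F : ℂ → ℂ) (a0 a1 a2 a3 a4 : ℂ) : Prop :=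
  ∃ H : ℂ → ℂ, DifferentiableOn ℂ H (Metric.ball 0 1) ∧ ∀ q ∈ Metric.ball (0 : ℂ) 1,
    F q = a0 + a1 * q + a2 * q ^ 2 + a3 * q ^ 3 + a4 * q ^ 4 + q ^ 5 * H q

/-- `F` agrees on the unit disc with `a₀ + … + a₅ q⁵ + q⁶ H(q)`, `H` holomorphic. -/
def Ex6 (F : ℂ → ℂ) (a0 a1 a2 a3 a4 a5 : ℂ) : Prop :=
  ∃ H : ℂ → ℂ, DifferentiableOn ℂ H (Metric.ball 0 1) ∧ ∀ q ∈ Metric.ball (0 : ℂ) 1,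
    F q = a0 + a1 * q + a2 * q ^ 2 + a3 * q ^ 3 + a4 * q ^ 4 + a5 * q ^ 5 + q ^ 6 * H q

lemma Ex5.mul {F G : ℂ → ℂ} {a0 a1 a2 a3 a4 b0 b1 b2 b3 b4 : ℂ}
    (hF : Ex5 F a0 a1 a2 a3 a4) (hG : Ex5 G b0 b1 b2 b3 b4) :
    Ex5 (fun q => F q * G q) (a0 * b0) (a0 * b1 + a1 * b0) (a0 * b2 + a1 * b1 + a2 * b0)
      (a0 * b3 + a1 * b2 + a2 * b1 + a3 * b0)
      (a0 * b4 + a1 * b3 + a2 * b2 + a3 * b1 + a4 * b0) := by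
  obtain ⟨H, hH, hF⟩ := hF
  obtain ⟨K, hK, hG⟩ := hG
  refine ⟨fun q => (a1 * b4 + a2 * b3 + a3 * b2 + a4 * b1)
      + (a2 * b4 + a3 * b3 + a4 * b2) * q + (a3 * b4 + a4 * b3) * q ^ 2 + a4 * b4 * q ^ 3
      + (a0 + a1 * q + a2 * q ^ 2 + a3 * q ^ 3 + a4 * q ^ 4) * K q
      + (b0 + b1 * q + b2 * q ^ 2 + b3 * q ^ 3 + b4 * q ^ 4) * H q
      + q ^ 5 * (H q * K q), by fun_prop, fun q hq => ?_⟩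
  simp only [hF q hq, hG q hq]
  ring

lemma sq_mem {q : ℂ} (hq : q ∈ Metric.ball (0 : ℂ) 1) : q ^ 2 ∈ Metric.ball (0 : ℂ) 1 := by
  simp only [mem_ball_zero_iff, norm_pow] at *
  exact pow_lt_one₀ (norm_nonneg _) hq (by norm_num)

lemma diff_comp_sq {H : ℂ → ℂ} (hH : DifferentiableOn ℂ H (Metric.ball 0 1)) :
    DifferentiableOn ℂ (fun q => H (q ^ 2)) (Metric.ball 0 1) :=
  hH.comp (f := fun q : ℂ => q ^ 2) (by fun_prop) (fun _ hq => sq_mem hq)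

lemma Ex5.comp_sq {F : ℂ → ℂ} {a0 a1 a2 a3 a4 : ℂ} (hF : Ex5 F a0 a1 a2 a3 a4) :
    Ex5 (fun q => F (q ^ 2)) a0 0 a1 0 a2 := by
  obtain ⟨H, hH, hF⟩ := hF
  have hH2 := diff_comp_sq hH
  refine ⟨fun q => a3 * q + a4 * q ^ 3 + q ^ 5 * H (q ^ 2), 
    DifferentiableOn.add (by fun_prop) (DifferentiableOn.mul (by fun_prop) hH2), fun q hq => ?_⟩
  simp only [hF _ (sq_mem hq)]
  ring

lemma Ex6.comp_sq {F : ℂ → ℂ} {a0 a1 a2 a3 a4 a5 : ℂ} (hF : Ex6 F a0 a1 a2 a3 a4 a5) :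
    Ex6 (fun q => F (q ^ 2)) a0 0 a1 0 a2 0 := by
  obtain ⟨H, hH, hF⟩ := hF
  have hH2 := diff_comp_sq hH
  refine ⟨fun q => a3 + a4 * q ^ 2 + a5 * q ^ 4 + q ^ 6 * H (q ^ 2), 
    DifferentiableOn.add (by fun_prop) (DifferentiableOn.mul (by fun_prop) hH2), fun q hq => ?_⟩
  simp only [hF _ (sq_mem hq)]
  ring

lemma Ex5.q_mul {F : ℂ → ℂ} {a0 a1 a2 a3 a4 : ℂ} (hF : Ex5 F a0 a1 a2 a3 a4) :
    Ex6 (fun q => q * F q) 0 a0 a1 a2 a3 a4 := by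
  obtain ⟨H, hH, hF⟩ := hF
  refine ⟨H, hH, fun q hq => ?_⟩
  simp only [hF q hq]
  ring

lemma Ex6.add {F G : ℂ → ℂ} {a0 a1 a2 a3 a4 a5 b0 b1 b2 b3 b4 b5 : ℂ}
    (hF : Ex6 F a0 a1 a2 a3 a4 a5) (hG : Ex6 G b0 b1 b2 b3 b4 b5) :
    Ex6 (fun q => F q + G q) (a0 + b0) (a1 + b1) (a2 + b2) (a3 + b3) (a4 + b4) (a5 + b5) := by
  obtain ⟨H, hH, hF⟩ := hF
  obtain ⟨K, hK, hG⟩ := hG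
  refine ⟨fun q => H q + K q, by fun_prop, fun q hq => ?_⟩
  simp only [hF q hq, hG q hq]
  ring

lemma Ex6.smul {F : ℂ → ℂ} {a0 a1 a2 a3 a4 a5 : ℂ} (c : ℂ)
    (hF : Ex6 F a0 a1 a2 a3 a4 a5) :
    Ex6 (fun q => c * F q) (c * a0) (c * a1) (c * a2) (c * a3) (c * a4) (c * a5) := by
  obtain ⟨H, hH, hF⟩ := hF
  refine ⟨fun q => c * H q, by fun_prop, fun q hq => ?_⟩
  simp only [hF q hq]
  ring

/-- The power series expansion with prescribed first six coefficients. -/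
lemma Ex6.exists_coeff {F : ℂ → ℂ} {a0 a1 a2 a3 a4 a5 : ℂ} (hF : Ex6 F a0 a1 a2 a3 a4 a5) :
    ∃ c : ℕ → ℂ, (∀ q ∈ Metric.ball (0 : ℂ) 1, F q = ∑' n : ℕ, c n * q ^ n) ∧
      c 0 = a0 ∧ c 1 = a1 ∧ c 2 = a2 ∧ c 3 = a3 ∧ c 4 = a4 ∧ c 5 = a5 := by
  obtain ⟨H, hH, hF⟩ := hF
  let h : ℕ → ℂ := fun n => ((Nat.factorial n : ℕ) : ℂ)⁻¹ * iteratedDeriv n H 0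
  let c : ℕ → ℂ := fun n => match n with
    | 0 => a0 | 1 => a1 | 2 => a2 | 3 => a3 | 4 => a4 | 5 => a5 | (k + 6) => h k
  refine ⟨c, fun q hq => ?_, rfl, rfl, rfl, rfl, rfl, rfl⟩
  have hs : HasSum (fun n => h n * q ^ n) (H q) := by
    have := Complex.hasSum_taylorSeries_on_ball hH hq
    refine hasSum_of_eq this fun n => ?_
    simp only [h, sub_zero, smul_eq_mul]
    ring
  have hs2 : HasSum (fun n => c (n + 6) * q ^ (n + 6)) (q ^ 6 * H q) := by
    have := hs.mul_left (q ^ 6)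
    refine hasSum_of_eq this fun n => ?_
    change _ = h n * q ^ (n + 6)
    ring
  have := (hasSum_nat_add_iff (f := fun n => c n * q ^ n) 6).1 hs2
  rw [this.tsum_eq, hF q hq]
  simp [Finset.sum_range_succ, c]
  ring

/-- The power series in `q` underlying `E₈`. -/
noncomputable def E8q (q : ℂ) : ℂ := 1 + 480 * ∑' n : ℕ, (sigma 7 (n + 1) : ℂ) * q ^ (n + 1)

lemma summable_aux {r : ℝ} (h0 : 0 < r) (h1 : r < 1) :
    Summable fun n : ℕ => ((n + 6 : ℕ) : ℝ) ^ 8 * r ^ n := by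
  have h := summable_pow_mul_geometric_of_norm_lt_one 8 (r := r)
    (by rwa [Real.norm_of_nonneg h0.le])
  have h2 := ((summable_nat_add_iff 6).2 h).mul_right (r ^ 6)⁻¹
  refine h2.congr fun n => ?_
  rw [pow_add]
  field_simp

lemma sigma_bound {r : ℝ} {w : ℂ} (hw : ‖w‖ ≤ r) (n : ℕ) :
    ‖(sigma 7 (n + 6) : ℂ) * w ^ n‖ ≤ ((n + 6 : ℕ) : ℝ) ^ 8 * r ^ n := by
  rw [norm_mul, norm_pow, Complex.norm_natCast]
  have : ((sigma 7 (n + 6) : ℕ) : ℝ) ≤ ((n + 6 : ℕ) : ℝ) ^ 8 := by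
    exact_mod_cast sigma_le_pow_succ 7 (n + 6)
  gcongr

lemma exists_rad {w : ℂ} (hw : w ∈ Metric.ball (0 : ℂ) 1) : ∃ r : ℝ, 0 < r ∧ r < 1 ∧ ‖w‖ < r := by
  obtain ⟨r, h1, h2⟩ := exists_between (mem_ball_zero_iff.1 hw)
  exact ⟨r, (norm_nonneg _).trans_lt h1, h2, h1⟩

lemma ex6_E8q : Ex6 E8q 1 480 (480 * 129) (480 * 2188) (480 * 16513) (480 * 78126) := by
  have hd : DifferentiableOn ℂ (fun q : ℂ => ∑' n : ℕ, (sigma 7 (n + 6) : ℂ) * q ^ n)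
      (Metric.ball 0 1) := by
    intro w hw
    obtain ⟨r, h0, h1, h2⟩ := exists_rad hw
    have := differentiableOn_tsum_of_summable_norm (U := Metric.ball (0 : ℂ) r)
      (F := fun (n : ℕ) (q : ℂ) => (sigma 7 (n + 6) : ℂ) * q ^ n) (summable_aux h0 h1)
      (fun i => by fun_prop) Metric.isOpen_ball
      (fun i w hw => sigma_bound (mem_ball_zero_iff.1 hw).le i)
    exact (this.differentiableAt
      (Metric.isOpen_ball.mem_nhds (mem_ball_zero_iff.2 h2))).differentiableWithinAt
  refine ⟨fun q => 480 * ∑' n : ℕ, (sigma 7 (n + 6) : ℂ) * q ^ n, by fun_prop, fun q hq => ?_⟩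
  obtain ⟨r, h0, h1, h2⟩ := exists_rad hq
  have hs : Summable fun n : ℕ => (sigma 7 (n + 6) : ℂ) * q ^ n :=
    Summable.of_norm_bounded (summable_aux h0 h1) (fun n => sigma_bound h2.le n)
  have hs2 : HasSum (fun n : ℕ => (sigma 7 (n + 5 + 1) : ℂ) * q ^ (n + 5 + 1))
      (q ^ 6 * ∑' n : ℕ, (sigma 7 (n + 6) : ℂ) * q ^ n) := by
    have := hs.hasSum.mul_left (q ^ 6)
    refine hasSum_of_eq this fun n => ?_
    ring
  have := (hasSum_nat_add_iff (f := fun n => (sigma 7 (n + 1) : ℂ) * q ^ (n + 1)) 5).1 hs2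
  have e1 : sigma 7 1 = 1 := by rfl
  have e2 : sigma 7 2 = 129 := by rfl
  have e3 : sigma 7 3 = 2188 := by rfl
  have e4 : sigma 7 4 = 16513 := by rfl
  have e5 : sigma 7 5 = 78126 := by rfl
  rw [E8q, this.tsum_eq]
  simp only [Finset.sum_range_succ, Finset.sum_range_zero, zero_add, Nat.reduceAdd, e1, e2, e3, e4,
    e5]
  push_cast
  ring

/-- Euler's function. -/
noncomputable def phiq (q : ℂ) : ℂ := ∏' n : ℕ, (1 - q ^ (n + 1))

lemma tail_bound {q : ℂ} (hq : ‖q‖ < 1 / 2) :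
    ‖∏' n : ℕ, (1 - q ^ (n + 5)) - 1‖ ≤ 4 * ‖q‖ ^ 5 := by
  have hq1 : ‖q‖ < 1 := by linarith
  have hsum : HasSum (fun n : ℕ => ‖-q ^ (n + 5)‖) ((1 - ‖q‖)⁻¹ * ‖q‖ ^ 5) := by
    have := (hasSum_geometric_of_lt_one (norm_nonneg q) hq1).mul_right (‖q‖ ^ 5)
    refine hasSum_of_eq this fun n => ?_
    rw [norm_neg, norm_pow, pow_add]
  have hm : Multipliable fun n : ℕ => 1 + -q ^ (n + 5) :=
    multipliable_one_add_of_summable hsum.summable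
  simp only [sub_eq_add_neg (1 : ℂ) (q ^ _)]
  have hb : ‖∏' n : ℕ, (1 + -q ^ (n + 5)) - 1‖ ≤ Real.exp ((1 - ‖q‖)⁻¹ * ‖q‖ ^ 5) - 1 := by
    refine le_of_tendsto ((hm.hasProd.sub_const 1).norm) (Filter.Eventually.of_forall fun t => ?_)
    refine (Finset.norm_prod_one_add_sub_one_le t _).trans ?_
    gcongr
    exact sum_le_hasSum t (fun _ _ => norm_nonneg _) hsum
  refine hb.trans ?_
  set x := (1 - ‖q‖)⁻¹ * ‖q‖ ^ 5 with hx
  have hi : (1 - ‖q‖)⁻¹ ≤ 2 := by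
    rw [inv_le_comm₀ (by linarith) (by norm_num)]
    linarith
  have hx0 : 0 ≤ x := mul_nonneg (inv_nonneg.2 (by linarith)) (by positivity)
  have hx2 : x ≤ 2 * ‖q‖ ^ 5 := by
    rw [hx]; gcongr
  have hp : ‖q‖ ^ 5 ≤ (1 / 2) ^ 5 := pow_le_pow_left₀ (norm_nonneg _) hq.le 5
  have := Real.abs_exp_sub_one_le (x := x) (by rw [abs_of_nonneg hx0]; linarith)
  rw [abs_of_nonneg hx0] at this
  linarith [le_abs_self (Real.exp x - 1)]

lemma phiq_split {q : ℂ} (hq : ‖q‖ < 1) :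
    phiq q = (1 - q) * (1 - q ^ 2) * (1 - q ^ 3) * (1 - q ^ 4) * ∏' n : ℕ, (1 - q ^ (n + 5)) := by
  have hm : Multipliable fun n : ℕ => 1 + -q ^ (n + 4 + 1) := by
    apply multipliable_one_add_of_summable
    simpa using (summable_nat_add_iff 5).2 (summable_geometric_of_lt_one (norm_nonneg q) hq)
  simp only [← sub_eq_add_neg] at hm
  have := Multipliable.prod_mul_tprod_nat_mul' (f := fun n : ℕ => 1 - q ^ (n + 1)) (k := 4) hm
  rw [phiq, ← this]
  simp [Finset.prod_range_succ, add_assoc]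

lemma ex5_phiq : Ex5 phiq 1 (-1) (-1) 0 0 := by
  have hd : DifferentiableOn ℂ phiq (Metric.ball 0 1) :=
    ModularForm.differentiableOn_tprod_one_sub_pow
  let K : ℂ → ℂ := fun q => (phiq q - (1 - q - q ^ 2)) / q ^ 5
  have hK : DifferentiableOn ℂ K (Metric.ball 0 1 \ {0}) := by
    refine DifferentiableOn.div ?_ (by fun_prop) ?_
    · exact (hd.mono Set.sdiff_subset).sub (by fun_prop)
    · intro x hx
      exact pow_ne_zero _ hx.2
  have hbd : Filter.IsBoundedUnder (· ≤ ·) (nhdsWithin 0 {0}ᶜ) (norm ∘ fun z => K z - K 0) := by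
    refine ⟨69, ?_⟩
    rw [Filter.eventually_map]
    filter_upwards [nhdsWithin_le_nhds (Metric.ball_mem_nhds (0 : ℂ) (ε := 1 / 2) (by norm_num)),
      self_mem_nhdsWithin] with q hq hq0
    have hq0 : q ≠ 0 := hq0
    have hq : ‖q‖ < 1 / 2 := mem_ball_zero_iff.1 hq
    have hK0 : K 0 = 0 := by simp [K]
    have ht := tail_bound hq
    have hn : ∀ k : ℕ, ‖1 - q ^ k‖ ≤ 2 := fun k => by
      refine (norm_sub_le _ _).trans ?_
      have : ‖q ^ k‖ ≤ 1 := by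
        rw [norm_pow]; exact pow_le_one₀ (norm_nonneg _) (by linarith)
      rw [norm_one]; linarith
    have hnk : ∀ k : ℕ, ‖q ^ k‖ ≤ 1 := fun k => by
      rw [norm_pow]; exact pow_le_one₀ (norm_nonneg _) (by linarith)
    set R := ∏' n : ℕ, (1 - q ^ (n + 5)) with hR
    have e : phiq q - (1 - q - q ^ 2) =
        (1 - q ^ 1) * (1 - q ^ 2) * (1 - q ^ 3) * (1 - q ^ 4) * (R - 1)
          + q ^ 5 * (2 - q ^ 3 - q ^ 4 + q ^ 5) := by
      rw [phiq_split (by linarith), ← hR]; ring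
    have h1 : ‖(1 - q ^ 1) * (1 - q ^ 2) * (1 - q ^ 3) * (1 - q ^ 4) * (R - 1)‖
        ≤ 2 * 2 * 2 * 2 * (4 * ‖q‖ ^ 5) := by
      simp only [norm_mul]
      gcongr <;> apply hn
    have h2 : ‖2 - q ^ 3 - q ^ 4 + q ^ 5‖ ≤ 5 := by
      have a1 := norm_add_le (2 - q ^ 3 - q ^ 4) (q ^ 5)
      have a2 := norm_sub_le (2 - q ^ 3) (q ^ 4)
      have a3 := norm_sub_le 2 (q ^ 3)
      have a4 : ‖(2 : ℂ)‖ = 2 := by simp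
      linarith [hnk 3, hnk 4, hnk 5]
    have hpos : 0 < ‖q‖ ^ 5 := by positivity
    simp only [Function.comp, hK0, sub_zero, K]
    rw [norm_div, norm_pow, div_le_iff₀ hpos, e]
    refine (norm_add_le _ _).trans ?_
    rw [norm_mul (q ^ 5), norm_pow]
    nlinarith
  have hU := Complex.differentiableOn_update_limUnder_of_isLittleO
    (Metric.ball_mem_nhds (0 : ℂ) one_pos) hK hbd.isLittleO_sub_self_inv
  refine ⟨_, hU, fun q hq => ?_⟩
  by_cases h : q = 0
  · subst h
    simp [phiq]
  · rw [Function.update_of_ne h]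
    simp only [K]
    field_simp
    ring

/-- The function of `q` underlying the newform. -/
noncomputable def fq (q : ℂ) : ℂ :=
  q * ∏' n : ℕ, ((1 - q ^ (n + 1)) ^ 8 * (1 - q ^ (2 * (n + 1))) ^ 8)

lemma fq_eq {q : ℂ} (hq : q ∈ Metric.ball (0 : ℂ) 1) :
    fq q = q * (phiq q ^ 8 * phiq (q ^ 2) ^ 8) := by
  have h1 := ModularForm.multipliable_one_sub_pow (mem_ball_zero_iff.1 hq)
  have h2 := ModularForm.multipliable_one_sub_pow (mem_ball_zero_iff.1 (sq_mem hq))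
  have e := (h1.pow 8).tprod_mul (h2.pow 8)
  rw [h1.tprod_pow, h2.tprod_pow] at e
  simp only [fq, phiq, pow_mul]
  rw [← e]

lemma ex6_fq : Ex6 fq 0 1 (-8) 12 64 (-210) := by
  have p1 := ex5_phiq
  have p2 := p1.mul p1
  have p4 := p2.mul p2
  have p8 := p4.mul p4
  obtain ⟨H, hH, h⟩ := (p8.mul p8.comp_sq).q_mul
  refine ⟨H, hH, fun q hq => ?_⟩
  rw [fq_eq hq]
  have := h q hq
  ring_nf at this ⊢
  exact this

lemma qexp_mem (z : ℍ) : qexp z ∈ Metric.ball (0 : ℂ) 1 :=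
  mem_ball_zero_iff.2 (UpperHalfPlane.norm_exp_two_pi_I_lt_one z)

lemma qexp_scale (m : ℕ) (hm : 0 < m) (z : ℍ) : qexp (scaleUH m hm z) = qexp z ^ m := by
  rw [qexp, qexp, ← Complex.exp_nat_mul]
  congr 1
  change 2 * Real.pi * Complex.I * ((m : ℂ) * (z : ℂ)) = _
  ring

/-- **The extremal theta series in 16 dimensions.**
With `g¹(z)=E₈(z)`, `g²(z)=16E₈(2z)`, `g³(z)=256E₈(4z)`, `g⁴(z)=f(z)`, `g⁵(z)=16f(2z)`, the
combination `g = (1/136)g¹ − (121/2176)g² + (1/136)g³ − (60/17)g⁴ − (60/17)g⁵` has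
q-expansion `1 + 7680q³ + 4320q⁴ + 276480q⁵ + O(q⁶)`; in particular the coefficients of
`q¹` and `q²` vanish. -/
theorem extremal_theta_series_16 :
    ∃ c : ℕ → ℂ,
      (∀ z : ℍ,
        (1 / 136) * E8fun z
            - (121 / 2176) * (16 * E8fun (scaleUH 2 (by norm_num) z))
            + (1 / 136) * (256 * E8fun (scaleUH 4 (by norm_num) z))
            - (60 / 17) * newform8fun z
            - (60 / 17) * (16 * newform8fun (scaleUH 2 (by norm_num) z))
          = ∑' n : ℕ, c n * qexp z ^ n) ∧
      c 0 = 1 ∧ c 1 = 0 ∧ c 2 = 0 ∧ c 3 = 7680 ∧ c 4 = 4320 ∧ c 5 = 276480 := by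
  have hE := ex6_E8q
  have hE2 := hE.comp_sq
  have hE4 := hE2.comp_sq
  have hf := ex6_fq
  have hf2 := hf.comp_sq
  obtain ⟨c, hc, h0, h1, h2, h3, h4, h5⟩ :=
    ((((hE.smul (1 / 136)).add (hE2.smul (-(121 / 136)))).add (hE4.smul (256 / 136))).add
      ((hf.smul (-(60 / 17))).add (hf2.smul (-(960 / 17))))).exists_coeff
  refine ⟨c, fun z => ?_, ?_, ?_, ?_, ?_, ?_, ?_⟩
  · rw [← hc _ (qexp_mem z)]
    have a : ∀ w, E8fun w = E8q (qexp w) := fun _ => rfl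
    have b : ∀ w, newform8fun w = fq (qexp w) := fun _ => rfl
    simp only [a, b, qexp_scale, ← pow_mul, Nat.reduceMul]
    ring
  · rw [h0]; norm_num
  · rw [h1]; norm_num
  · rw [h2]; norm_num
  · rw [h3]; norm_num
  · rw [h4]; norm_num
  · rw [h5]; norm_num
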